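/- For every integer k ≥ 3, the infinite series S_k = ∑_{n=1}^∞ 1/((k·n)² − 1) converges and equals (1 − (π/k)·cot(π/k))/2. -/

import Mathlib

/-- For every integer `k ≥ 3`, the series `S_k = ∑_{n=1}^∞ 1/((k·n)² − 1)` converges
and equals `(1 − (π/k)·cot(π/k))/2`. -/
theorem S_k_eq (k : ℕ) (hk : 3 ≤ k) :
    HasSum (fun n : ℕ => 1 / (((k : ℝ) * (n + 1)) ^ 2 - 1))
      ((1 - (Real.pi / k) * Real.cot (Real.pi / k)) / 2) := by
  have hk0 : (k : ℂ) ≠ 0 := by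
    have : k ≠ 0 := by omega
    exact_mod_cast this
  have hx : (1 / (k : ℂ)) ∈ Complex.integerComplement := by
    rintro ⟨m, hm⟩
    have hm' : (m : ℂ) = 1 / (k : ℂ) := hm
    rw [eq_div_iff hk0] at hm'
    have h2 : m * (k : ℤ) = 1 := by exact_mod_cast hm'
    have h3 : (k : ℤ) ∣ 1 := ⟨m, by rw [← h2]; ring⟩
    have := Int.le_of_dvd one_pos h3
    omega
  have hs := (summable_cotTerm hx).hasSum_iff_tendsto_nat.mpr (tendsto_logDeriv_euler_cot_sub hx)
  have hs2 := hs.mul_left (-1 / (2 * (k : ℂ)))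
  rw [← Complex.hasSum_ofReal]
  convert hs2 using 1
  · rfl
  · funext n
    have hne : ((k : ℂ) * (n + 1)) ^ 2 - 1 ≠ 0 := by
      intro h
      have h1 : (k * (n + 1)) ^ 2 = 1 := by
        have := sub_eq_zero.mp h
        exact_mod_cast this
      nlinarith [Nat.zero_le (k * n)]
    have ha : 1 + (k : ℂ) * (n + 1) ≠ 0 := fun h => hne (by linear_combination ((k : ℂ) * (n + 1) - 1) * h)
    have hb : 1 - (k : ℂ) * (n + 1) ≠ 0 := fun h => hne (by linear_combination (-(k : ℂ) * (n + 1) - 1) * h)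
    rw [cotTerm_identity hx]
    have e1 : (1 / (k : ℂ) + (n + 1)) = (1 + (k : ℂ) * (n + 1)) / k := by field_simp
    have e2 : (1 / (k : ℂ) - (n + 1)) = (1 - (k : ℂ) * (n + 1)) / k := by field_simp
    rw [e1, e2]
    push_cast
    rw [show ((k : ℂ) * (n + 1)) ^ 2 - 1 = -((1 + (k : ℂ) * (n + 1)) * (1 - (k : ℂ) * (n + 1))) by ring]
    generalize 1 + (k : ℂ) * (n + 1) = a at *
    generalize 1 - (k : ℂ) * (n + 1) = b at *
    field_simp
  · push_cast
    rw [mul_one_div]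
    field_simp
    ring
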